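/- arXiv:2112.13190 — 2 statements merged into one kernel-verified Lean document; each statement's English description precedes it below -/
import Mathlib

section
/- For every ε > 0 there exists a constant c = c(ε) > 0 such that the following holds: for every finite graph G and every probability p with 0 < p ≤ 1 satisfying e(G)·p / v(G) ≥ c, with probability at least 1 − ε the following event occurs: for every partition 𝒜 of V(G) there exists a partition 𝒜′ of V(G), each of whose parts is a union of parts of 𝒜 (and which depends only on the realization of G_p and on 𝒜), such that δ_{𝒜′}(G) ≤ δ_𝒜(G_p) + ε. -/
open Finset
open scoped Classical

/-- The number of edges of a finite graph. -/
noncomputable def edgeCount {V : Type} [Fintype V] [DecidableEq V] (G : SimpleGraph V) : ℕ :=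
  G.edgeFinset.card

/-- vol(A): the sum over vertices of A of their degree in G. -/
noncomputable def degSum {V : Type} [Fintype V] [DecidableEq V] (G : SimpleGraph V)
    (A : Finset V) : ℕ :=
  ∑ v ∈ A, G.degree v

/-- e(A): the number of edges of G with both endpoints in A. -/
noncomputable def intEdges {V : Type} [Fintype V] [DecidableEq V] (G : SimpleGraph V)
    (A : Finset V) : ℕ :=
  (G.edgeFinset.filter (fun e => ∀ v ∈ e, v ∈ A)).card

/-- The modularity score q_𝒜(G) of a vertex partition 𝒜 of G; it is 0 if G has no edges. -/
noncomputable def modScore {V : Type} [Fintype V] [DecidableEq V] (G : SimpleGraph V)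
    (P : Finpartition (univ : Finset V)) : ℝ :=
  if edgeCount G = 0 then 0 else
    (∑ A ∈ P.parts, (intEdges G A : ℝ)) / (edgeCount G : ℝ)
      - (∑ A ∈ P.parts, (degSum G A : ℝ) ^ 2) / (4 * (edgeCount G : ℝ) ^ 2)

/-- The modularity q*(G) of a graph: the maximum of q_𝒜(G) over all vertex partitions 𝒜. -/
noncomputable def modularity {V : Type} [Fintype V] [DecidableEq V] (G : SimpleGraph V) : ℝ :=
  ⨆ P : Finpartition (univ : Finset V), modScore G P

/-- The probability that the random subgraph G_p of G (each edge of G retained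
independently with probability p) satisfies the predicate Q. -/
noncomputable def subgraphProb {V : Type} [Fintype V] [DecidableEq V] (G : SimpleGraph V)
    (p : ℝ) (Q : SimpleGraph V → Prop) : ℝ :=
  ∑ F ∈ G.edgeFinset.powerset,
    if Q (SimpleGraph.fromEdgeSet (F : Set (Sym2 V))) then
      p ^ F.card * (1 - p) ^ (G.edgeFinset.card - F.card)
    else 0

section Weights

variable {α : Type}

/-- The probability that the random subset of `E` retaining each element independently with
probability `p` equals `F`. -/
noncomputable def retainWeight (E : Finset α) (p : ℝ) (F : Finset α) : ℝ :=
  p ^ F.card * (1 - p) ^ (E.card - F.card)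

lemma retainWeight_nonneg (E F : Finset α) {p : ℝ} (hp : 0 ≤ p) (hp1 : p ≤ 1) :
    0 ≤ retainWeight E p F := by
  have : 0 ≤ 1 - p := by linarith
  unfold retainWeight
  positivity

lemma sum_retainWeight (E : Finset α) (p : ℝ) :
    ∑ F ∈ E.powerset, retainWeight E p F = 1 := by
  unfold retainWeight
  rw [sum_pow_mul_eq_add_pow]
  simp

lemma sum_retainWeight_mul_exp [DecidableEq α] (E T : Finset α) (hT : T ⊆ E) (p t : ℝ) :
    ∑ F ∈ E.powerset, retainWeight E p F * Real.exp (t * ((F ∩ T).card : ℝ)) =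
      (p * Real.exp t + (1 - p)) ^ T.card := by
  have h := prod_add (fun i => p * (if i ∈ T then Real.exp t else 1)) (fun _ => 1 - p) E
  have hL : ∏ i ∈ E, (p * (if i ∈ T then Real.exp t else 1) + (1 - p)) =
      (p * Real.exp t + (1 - p)) ^ T.card := by
    rw [← prod_const, ← prod_subset hT]
    · exact prod_congr rfl fun i hi => by simp [hi]
    · intro i _ hi
      simp [hi]
  rw [← hL, h]
  refine sum_congr rfl fun F hF => ?_
  rw [prod_mul_distrib, prod_const, prod_const, card_sdiff_of_subset (mem_powerset.1 hF),
    prod_ite_mem, prod_const, ← Real.exp_nat_mul, mul_comm t, retainWeight]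
  ring

/-- An exponential moment bound for the centred size of a random subset. -/
lemma sum_retainWeight_mul_exp_centered_le [DecidableEq α] (E T : Finset α)
    (hT : T ⊆ E) {p t : ℝ} (hp : 0 ≤ p) (hp1 : p ≤ 1) (ht : |t| ≤ 1) :
    ∑ F ∈ E.powerset, retainWeight E p F *
        Real.exp (t * (((F ∩ T).card : ℝ) - p * (T.card : ℝ))) ≤
      Real.exp (p * (E.card : ℝ) * t ^ 2) := by
  have hsplit : ∀ F ∈ E.powerset, retainWeight E p F *
        Real.exp (t * (((F ∩ T).card : ℝ) - p * (T.card : ℝ))) =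
      retainWeight E p F * Real.exp (t * ((F ∩ T).card : ℝ)) *
        Real.exp (-(t * p * (T.card : ℝ))) := by
    intro F _
    rw [mul_assoc, ← Real.exp_add]
    ring_nf
  have hbase : 0 ≤ p * Real.exp t + (1 - p) := by
    have := Real.exp_pos t
    have : 0 ≤ 1 - p := by linarith
    positivity
  have hbase_le : p * Real.exp t + (1 - p) ≤ Real.exp (p * (Real.exp t - 1)) := by
    have := Real.add_one_le_exp (p * (Real.exp t - 1))
    linarith
  have hquad : Real.exp t - 1 - t ≤ t ^ 2 :=
    (le_abs_self _).trans (Real.abs_exp_sub_one_sub_id_le ht)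
  have hcard : (T.card : ℝ) ≤ E.card := by exact_mod_cast card_le_card hT
  rw [sum_congr rfl hsplit, ← sum_mul, sum_retainWeight_mul_exp E T hT]
  calc (p * Real.exp t + (1 - p)) ^ T.card * Real.exp (-(t * p * (T.card : ℝ)))
      ≤ Real.exp (p * (Real.exp t - 1)) ^ T.card * Real.exp (-(t * p * (T.card : ℝ))) := by
        gcongr
    _ = Real.exp (p * (T.card : ℝ) * (Real.exp t - 1 - t)) := by
        rw [← Real.exp_nat_mul, ← Real.exp_add]
        ring_nf
    _ ≤ Real.exp (p * (E.card : ℝ) * t ^ 2) := by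
        have := Real.add_one_le_exp t
        gcongr
        linarith

/-- A two-sided Chernoff bound. -/
lemma sum_retainWeight_deviation_le [DecidableEq α] (E T : Finset α)
    (hT : T ⊆ E) {p δ : ℝ} (hp : 0 ≤ p) (hp1 : p ≤ 1) (hδ : 0 ≤ δ) (hδ2 : δ ≤ 2) :
    ∑ F ∈ E.powerset, (if δ * (p * (E.card : ℝ)) < |((F ∩ T).card : ℝ) - p * (T.card : ℝ)| then
        retainWeight E p F else 0) ≤
      2 * Real.exp (-(p * (E.card : ℝ) * δ ^ 2 / 4)) := by
  set X : Finset α → ℝ := fun F => ((F ∩ T).card : ℝ) - p * (T.card : ℝ) with hX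
  set c : ℝ := Real.exp (-(δ / 2 * (δ * (p * (E.card : ℝ))))) with hc
  have hc0 : 0 < c := Real.exp_pos _
  have hpoint : ∀ F ∈ E.powerset,
      (if δ * (p * (E.card : ℝ)) < |X F| then retainWeight E p F else 0) ≤
        (retainWeight E p F * Real.exp (δ / 2 * X F) +
          retainWeight E p F * Real.exp (-(δ / 2) * X F)) * c := by
    intro F _
    have hw := retainWeight_nonneg E F hp hp1
    split_ifs with h
    · have hone : 1 ≤ (Real.exp (δ / 2 * X F) + Real.exp (-(δ / 2) * X F)) * c := by
        rw [hc, add_mul, ← Real.exp_add, ← Real.exp_add]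
        rcases lt_abs.1 h with h | h
        · have h1 : 1 ≤ Real.exp (δ / 2 * X F + -(δ / 2 * (δ * (p * (E.card : ℝ))))) := by
            apply Real.one_le_exp
            nlinarith
          have := Real.exp_pos (-(δ / 2) * X F + -(δ / 2 * (δ * (p * (E.card : ℝ)))))
          linarith
        · have h1 : 1 ≤ Real.exp (-(δ / 2) * X F + -(δ / 2 * (δ * (p * (E.card : ℝ))))) := by
            apply Real.one_le_exp
            nlinarith
          have := Real.exp_pos (δ / 2 * X F + -(δ / 2 * (δ * (p * (E.card : ℝ)))))
          linarith
      calc retainWeight E p F = retainWeight E p F * 1 := (mul_one _).symm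
        _ ≤ retainWeight E p F * ((Real.exp (δ / 2 * X F) + Real.exp (-(δ / 2) * X F)) * c) := by
            gcongr
        _ = _ := by ring
    · positivity
  have hup := sum_retainWeight_mul_exp_centered_le E T hT hp hp1 (t := δ / 2)
    (by rw [abs_le]; constructor <;> linarith)
  have hlow := sum_retainWeight_mul_exp_centered_le E T hT hp hp1 (t := -(δ / 2))
    (by rw [abs_le]; constructor <;> linarith)
  calc _ ≤ _ := sum_le_sum hpoint
    _ ≤ (Real.exp (p * (E.card : ℝ) * (δ / 2) ^ 2) +
          Real.exp (p * (E.card : ℝ) * (-(δ / 2)) ^ 2)) * c := by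
        rw [← sum_mul, sum_add_distrib]
        gcongr
    _ = 2 * (Real.exp (p * (E.card : ℝ) * (δ / 2) ^ 2) * c) := by
        rw [neg_sq]
        ring
    _ = _ := by
        rw [hc, ← Real.exp_add]
        ring_nf

/-- If an event contains the event that every set of a family has about the expected number of
retained elements, then it is as likely as the union bound predicts. -/
lemma one_sub_le_sum_retainWeight [DecidableEq α] {ι : Type} [Fintype ι] (E : Finset α)
    (T : ι → Finset α) (hT : ∀ i, T i ⊆ E) {p δ : ℝ} (hp : 0 ≤ p) (hp1 : p ≤ 1) (hδ : 0 ≤ δ)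
    (hδ2 : δ ≤ 2) (Q : Finset α → Prop)
    (hQ : ∀ F ⊆ E, (∀ i, |((F ∩ T i).card : ℝ) - p * ((T i).card : ℝ)| ≤
      δ * (p * (E.card : ℝ))) → Q F) :
    1 - (Fintype.card ι : ℝ) * (2 * Real.exp (-(p * (E.card : ℝ) * δ ^ 2 / 4))) ≤
      ∑ F ∈ E.powerset, if Q F then retainWeight E p F else 0 := by
  set bad : ι → Finset α → Prop := fun i F =>
    δ * (p * (E.card : ℝ)) < |((F ∩ T i).card : ℝ) - p * ((T i).card : ℝ)| with hbad
  have hpoint : ∀ F ∈ E.powerset, retainWeight E p F ≤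
      (if Q F then retainWeight E p F else 0) +
        ∑ i, if bad i F then retainWeight E p F else 0 := by
    intro F hF
    have hw := retainWeight_nonneg E F hp hp1
    have hnonneg : ∀ i ∈ (univ : Finset ι), 0 ≤ if bad i F then retainWeight E p F else 0 := by
      intro i _
      split_ifs <;> simp [hw]
    by_cases hq : Q F
    · simpa [hq] using sum_nonneg hnonneg
    · have : ∃ i, bad i F := by
        by_contra! hcon
        exact hq (hQ F (mem_powerset.1 hF) fun i => not_lt.1 (hcon i))
      obtain ⟨i, hi⟩ := this
      have := single_le_sum hnonneg (mem_univ i)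
      simpa [hq, hi] using this
  have hsum := sum_le_sum hpoint
  rw [sum_retainWeight, sum_add_distrib, sum_comm] at hsum
  have hunion : ∑ i, ∑ F ∈ E.powerset, (if bad i F then retainWeight E p F else 0) ≤
      (Fintype.card ι : ℝ) * (2 * Real.exp (-(p * (E.card : ℝ) * δ ^ 2 / 4))) := by
    calc _ ≤ ∑ _i : ι, 2 * Real.exp (-(p * (E.card : ℝ) * δ ^ 2 / 4)) :=
          sum_le_sum fun i _ => sum_retainWeight_deviation_le E (T i) (hT i) hp hp1 hδ hδ2
      _ = _ := by simp [card_univ]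
  linarith

end Weights

/-- Items with nonnegative weights can be put into `k` boxes so that the squared loads sum to at
most the sum of the squared weights plus the `k`-th part of the squared total weight. -/
lemma exists_box_sum_sq_le {α : Type} [DecidableEq α] (w : α → ℝ) (k : ℕ) (hk : 0 < k)
    (T : Finset α) (hw : ∀ i ∈ T, 0 ≤ w i) :
    ∃ f : α → Fin k, ∑ j, (∑ i ∈ T with f i = j, w i) ^ 2 ≤
      ∑ i ∈ T, w i ^ 2 + (∑ i ∈ T, w i) ^ 2 / k := by
  induction T using Finset.induction_on with
  | empty => exact ⟨fun _ => ⟨0, hk⟩, by simp⟩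
  | insert a T ha ih =>
    obtain ⟨f, hf⟩ := ih fun i hi => hw i (mem_insert_of_mem hi)
    have hwa := hw a (mem_insert_self a T)
    have hkR : (0 : ℝ) < k := by exact_mod_cast hk
    have : Nonempty (Fin k) := ⟨⟨0, hk⟩⟩
    set L : Fin k → ℝ := fun j => ∑ i ∈ T with f i = j, w i with hL
    have hLsum : ∑ j, L j = ∑ i ∈ T, w i := sum_fiberwise T f w
    obtain ⟨j₀, -, hj₀⟩ := exists_le_of_sum_le (s := (univ : Finset (Fin k))) (f := L)
      (g := fun _ => (∑ i ∈ T, w i) / k) univ_nonempty (by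
        rw [hLsum]
        simp only [sum_const, card_univ, Fintype.card_fin, nsmul_eq_mul]
        rw [mul_div_cancel₀ _ hkR.ne'])
    refine ⟨Function.update f a j₀, ?_⟩
    have hload : ∀ j, ∑ i ∈ insert a T with Function.update f a j₀ i = j, w i =
        L j + if j = j₀ then w a else 0 := by
      intro j
      rw [sum_filter, sum_insert ha, hL]
      simp only [Function.update_self, sum_filter]
      rw [add_comm]
      congr 1
      · refine sum_congr rfl fun i hi => ?_
        have : i ≠ a := fun h => ha (h ▸ hi)
        simp [this]
      · simp [eq_comm]
    have hsq : ∀ j, (L j + if j = j₀ then w a else 0) ^ 2 =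
        L j ^ 2 + if j = j₀ then 2 * w a * L j + w a ^ 2 else 0 := by
      intro j
      split_ifs <;> ring
    simp only [hload, hsq, sum_add_distrib, sum_ite_eq', mem_univ, if_true]
    rw [sum_insert ha, sum_insert ha]
    set W := ∑ i ∈ T, w i
    have h1 : 2 * w a * L j₀ ≤ 2 * w a * (W / k) := by gcongr
    have h2 : (w a + W) ^ 2 / k = W ^ 2 / k + 2 * w a * (W / k) + w a ^ 2 / k := by
      field_simp
      ring
    have h3 : 0 ≤ w a ^ 2 / (k : ℝ) := by positivity
    linarith

lemma edgeFinset_fromEdgeSet_of_subset {V : Type} [Fintype V] {G : SimpleGraph V}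
    {F : Finset (Sym2 V)} (hF : F ⊆ G.edgeFinset)
    {_ : Fintype (SimpleGraph.fromEdgeSet (F : Set (Sym2 V))).edgeSet} :
    (SimpleGraph.fromEdgeSet (F : Set (Sym2 V))).edgeFinset = F := by
  ext e
  rw [SimpleGraph.mem_edgeFinset, SimpleGraph.edgeSet_fromEdgeSet]
  simp only [Set.mem_sdiff, mem_coe, and_iff_left_iff_imp]
  exact fun he => G.not_isDiag_of_mem_edgeSet (SimpleGraph.mem_edgeFinset.1 (hF he))

section Graphs

variable {V : Type} [Fintype V] [DecidableEq V] (G H : SimpleGraph V)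

lemma degSum_add_intEdges_compl (S : Finset V) :
    degSum G S + intEdges G Sᶜ = edgeCount G + intEdges G S := by
  have hdeg : degSum G S = ∑ e ∈ G.edgeFinset, (S.filter (fun v => v ∈ e)).card := by
    unfold degSum
    refine Eq.trans ?_ (sum_card_bipartiteAbove_eq_sum_card_bipartiteBelow (fun v e => v ∈ e))
    refine sum_congr rfl fun v _ => ?_
    rw [← G.card_incidenceFinset_eq_degree, G.incidenceFinset_eq_filter]
    rfl
  rw [hdeg]
  unfold intEdges edgeCount
  rw [card_filter, card_filter, card_eq_sum_ones, ← sum_add_distrib, ← sum_add_distrib]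
  refine sum_congr rfl fun e he => ?_
  induction e with
  | h a b =>
    have hab : a ≠ b := (SimpleGraph.mem_edgeFinset.1 he : G.Adj a b).ne
    have hcount : (S.filter (fun v => v ∈ s(a, b))).card =
        (if a ∈ S then 1 else 0) + if b ∈ S then 1 else 0 := by
      have : S.filter (fun v => v ∈ s(a, b)) = S.filter (· = a) ∪ S.filter (· = b) := by
        ext v
        simp only [mem_filter, Sym2.mem_iff, mem_union]
        tauto
      rw [this, card_union_of_disjoint]
      · rw [filter_eq', filter_eq']
        split_ifs <;> simp
      · rw [disjoint_left]
        intro v h1 h2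
        exact hab ((mem_filter.1 h1).2.symm.trans (mem_filter.1 h2).2)
    rw [hcount]
    by_cases ha : a ∈ S <;> by_cases hb : b ∈ S <;> simp [ha, hb]

/-- The proportion of the edges that are internal to `S`. -/
noncomputable def edgeFrac (S : Finset V) : ℝ := (intEdges G S : ℝ) / edgeCount G

lemma intEdges_le_edgeCount (S : Finset V) : intEdges G S ≤ edgeCount G :=
  card_le_card (filter_subset _ _)

lemma edgeFrac_nonneg (S : Finset V) : 0 ≤ edgeFrac G S := by
  unfold edgeFrac
  positivity

lemma edgeFrac_le_one (S : Finset V) : edgeFrac G S ≤ 1 :=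
  div_le_one_of_le₀ (by exact_mod_cast intEdges_le_edgeCount G S) (by positivity)

variable {G H}

lemma degSum_eq_edgeFrac (hG : edgeCount G ≠ 0) (S : Finset V) :
    (degSum G S : ℝ) / (2 * edgeCount G) = (1 + edgeFrac G S - edgeFrac G Sᶜ) / 2 := by
  have h : (degSum G S : ℝ) + intEdges G Sᶜ = edgeCount G + intEdges G S := by
    exact_mod_cast degSum_add_intEdges_compl G S
  have hG' : (edgeCount G : ℝ) ≠ 0 := by exact_mod_cast hG
  unfold edgeFrac
  field_simp
  linarith

lemma modScore_eq_sum_sub_sum (hG : edgeCount G ≠ 0) (P : Finpartition (univ : Finset V)) :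
    modScore G P = ∑ A ∈ P.parts, edgeFrac G A -
      ∑ A ∈ P.parts, ((degSum G A : ℝ) / (2 * edgeCount G)) ^ 2 := by
  rw [modScore, if_neg hG, sum_div, sum_div]
  congr 1
  refine sum_congr rfl fun A _ => ?_
  rw [div_pow, mul_pow]
  norm_num

/-- Graphs with similar proportions of internal edges have similar modularity scores on
partitions with few parts. -/
lemma abs_modScore_sub_modScore_le (hG : edgeCount G ≠ 0) (hH : edgeCount H ≠ 0) {η : ℝ}
    (h : ∀ S, |edgeFrac G S - edgeFrac H S| ≤ η) (P : Finpartition (univ : Finset V)) :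
    |modScore G P - modScore H P| ≤ P.parts.card * (3 * η) := by
  rw [modScore_eq_sum_sub_sum hG, modScore_eq_sum_sub_sum hH, ← sum_sub_distrib,
    ← sum_sub_distrib, ← sum_sub_distrib, ← nsmul_eq_mul]
  refine (abs_sum_le_sum_abs _ _).trans (sum_le_card_nsmul _ _ _ fun A _ => ?_)
  rw [degSum_eq_edgeFrac hG, degSum_eq_edgeFrac hH]
  have h1 := abs_le.1 (h A)
  have h2 := abs_le.1 (h Aᶜ)
  have a1 := edgeFrac_nonneg G A
  have a2 := edgeFrac_le_one G A
  have a3 := edgeFrac_nonneg G Aᶜ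
  have a4 := edgeFrac_le_one G Aᶜ
  have b1 := edgeFrac_nonneg H A
  have b2 := edgeFrac_le_one H A
  have b3 := edgeFrac_nonneg H Aᶜ
  have b4 := edgeFrac_le_one H Aᶜ
  set x := edgeFrac G A
  set x' := edgeFrac G Aᶜ
  set y := edgeFrac H A
  set y' := edgeFrac H Aᶜ
  have hv : |(1 + x - x') / 2 - (1 + y - y') / 2| ≤ η := by
    rw [abs_le]
    constructor <;> linarith
  have hs : |(1 + x - x') / 2 + (1 + y - y') / 2| ≤ 2 := by
    rw [abs_le]
    constructor <;> linarith
  have hη : 0 ≤ η := (abs_nonneg _).trans hv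
  have hsq : |((1 + x - x') / 2) ^ 2 - ((1 + y - y') / 2) ^ 2| ≤ 2 * η := by
    rw [sq_sub_sq, abs_mul]
    gcongr
  have hsq' := abs_le.1 hsq
  rw [abs_le]
  constructor <;> linarith

lemma sum_intEdges_le_of_le {P Q : Finpartition (univ : Finset V)} (h : P ≤ Q) :
    ∑ A ∈ P.parts, intEdges G A ≤ ∑ A ∈ Q.parts, intEdges G A := by
  have key : ∀ R : Finpartition (univ : Finset V), ∑ A ∈ R.parts, intEdges G A =
      (R.parts.biUnion fun A => G.edgeFinset.filter (fun e => ∀ v ∈ e, v ∈ A)).card := by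
    intro R
    rw [card_biUnion]
    · rfl
    · intro A hA B hB hAB
      rw [Function.onFun, disjoint_left]
      intro e h1 h2
      induction e with
      | h a b =>
        have ha := (mem_filter.1 h1).2 a (Sym2.mem_mk_left a b)
        have hb := (mem_filter.1 h2).2 a (Sym2.mem_mk_left a b)
        exact hAB (R.eq_of_mem_parts hA hB ha hb)
  rw [key, key]
  refine card_le_card fun e he => ?_
  obtain ⟨A, hA, heA⟩ := mem_biUnion.1 he
  obtain ⟨B, hB, hAB⟩ := h hA
  have heA' := mem_filter.1 heA
  exact mem_biUnion.2 ⟨B, hB, mem_filter.2 ⟨heA'.1, fun v hv => hAB (heA'.2 v hv)⟩⟩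

/-- Merging the parts of `P` according to a labelling of them by `Fin k`. -/
lemma exists_merge (P : Finpartition (univ : Finset V)) {k : ℕ} (f : Finset V → Fin k) :
    ∃ Q : Finpartition (univ : Finset V), P ≤ Q ∧ Q.parts.card ≤ k ∧
      ∀ g : Finset V → ℝ, g ∅ = 0 →
        ∑ A ∈ Q.parts, g A = ∑ j, g ({A ∈ P.parts | f A = j}.biUnion id) := by
  set B : Fin k → Finset V := fun j => {A ∈ P.parts | f A = j}.biUnion id with hB
  have hdisj : Set.PairwiseDisjoint (univ : Finset (Fin k)) B := by
    intro i _ j _ hij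
    rw [Function.onFun, disjoint_left]
    intro v hi hj
    simp only [hB, mem_biUnion, mem_filter, id] at hi hj
    obtain ⟨A, ⟨hA, rfl⟩, hvA⟩ := hi
    obtain ⟨A', ⟨hA', rfl⟩, hvA'⟩ := hj
    exact hij (by rw [P.eq_of_mem_parts hA hA' hvA hvA'])
  have hdisj' : Set.PairwiseDisjoint ((univ.image B : Finset (Finset V)) : Set (Finset V)) id := by
    intro S hS S' hS' hne
    simp only [coe_image, Set.mem_image] at hS hS'
    obtain ⟨i, hi, rfl⟩ := hS
    obtain ⟨j, hj, rfl⟩ := hS'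
    exact hdisj hi hj fun h => hne (h ▸ rfl)
  have hsup : (univ.image B).sup id = univ := by
    rw [eq_univ_iff_forall]
    intro v
    obtain ⟨A, hA, hv⟩ := P.exists_mem (mem_univ v)
    rw [mem_sup]
    exact ⟨B (f A), mem_image_of_mem _ (mem_univ _),
      mem_biUnion.2 ⟨A, mem_filter.2 ⟨hA, rfl⟩, hv⟩⟩
  refine ⟨Finpartition.ofErase (univ.image B) (supIndep_iff_pairwiseDisjoint.2 hdisj') hsup,
    ?_, ?_, ?_⟩
  · intro A hA
    have hsub : A ⊆ B (f A) := fun v hv => mem_biUnion.2 ⟨A, mem_filter.2 ⟨hA, rfl⟩, hv⟩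
    refine ⟨B (f A), mem_erase.2 ⟨?_, mem_image_of_mem _ (mem_univ _)⟩, hsub⟩
    exact ((P.nonempty_of_mem_parts hA).mono hsub).ne_empty
  · calc _ ≤ (univ.image B).card := card_le_card (erase_subset _ _)
      _ ≤ (univ : Finset (Fin k)).card := card_image_le
      _ = k := by simp
  · intro g hg
    rw [← sum_image_of_disjoint (f := B) (g := g) hg hdisj]
    exact sum_erase _ hg

/-- Every partition can be coarsened to one with at most `k` parts at a cost of at most `1 / k` in
modularity score. -/
lemma exists_coarsening_modScore_ge (hG : edgeCount G ≠ 0) (P : Finpartition (univ : Finset V))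
    {k : ℕ} (hk : 0 < k) :
    ∃ Q : Finpartition (univ : Finset V), P ≤ Q ∧ Q.parts.card ≤ k ∧
      modScore G P - 1 / k ≤ modScore G Q := by
  have hm : (0 : ℝ) < edgeCount G := by exact_mod_cast Nat.pos_of_ne_zero hG
  set w : Finset V → ℝ := fun A => (degSum G A : ℝ) / (2 * edgeCount G) with hw
  have hadd : ∀ T ⊆ P.parts, w (T.biUnion id) = ∑ A ∈ T, w A := by
    intro T hT
    simp only [hw, ← sum_div]
    congr 1
    unfold degSum
    rw [sum_biUnion fun A hA B hB hAB => P.disjoint (hT hA) (hT hB) hAB]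
    push_cast
    rfl
  have htotal : ∑ A ∈ P.parts, w A = 1 := by
    rw [← hadd _ subset_rfl, P.biUnion_parts, div_eq_one_iff_eq (by positivity)]
    have : degSum G univ = 2 * edgeCount G := by
      unfold degSum edgeCount
      convert G.sum_degrees_eq_twice_card_edges
    exact_mod_cast this
  obtain ⟨f, hf⟩ := exists_box_sum_sq_le w k hk P.parts fun A _ => by positivity
  obtain ⟨Q, hPQ, hcard, hsum⟩ := exists_merge P f
  refine ⟨Q, hPQ, hcard, ?_⟩
  have hsq : ∑ A ∈ Q.parts, w A ^ 2 ≤ ∑ A ∈ P.parts, w A ^ 2 + 1 / k := by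
    rw [hsum (fun A => w A ^ 2) (by simp [hw, degSum])]
    simpa [htotal, hadd _ (filter_subset _ _)] using hf
  have hinternal : ∑ A ∈ P.parts, edgeFrac G A ≤ ∑ A ∈ Q.parts, edgeFrac G A := by
    unfold edgeFrac
    rw [← sum_div, ← sum_div]
    have : (∑ A ∈ P.parts, (intEdges G A : ℝ)) ≤ ∑ A ∈ Q.parts, (intEdges G A : ℝ) := by
      exact_mod_cast sum_intEdges_le_of_le hPQ
    gcongr
  rw [modScore_eq_sum_sub_sum hG, modScore_eq_sum_sub_sum hG]
  linarith

lemma modScore_le_modularity (P : Finpartition (univ : Finset V)) :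
    modScore G P ≤ modularity G :=
  le_ciSup (Set.finite_range _).bddAbove P

lemma exists_modScore_eq_modularity (G : SimpleGraph V) :
    ∃ P : Finpartition (univ : Finset V), modScore G P = modularity G :=
  exists_eq_ciSup_of_finite

/-- Graphs with similar proportions of internal edges have similar modularity deficits, up to
coarsening the partition. -/
lemma exists_coarsening_deficit_le (hG : edgeCount G ≠ 0) (hH : edgeCount H ≠ 0) {η : ℝ}
    (hη : 0 ≤ η) (h : ∀ S, |edgeFrac G S - edgeFrac H S| ≤ η) {k : ℕ} (hk : 0 < k)
    (A : Finpartition (univ : Finset V)) :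
    ∃ A' : Finpartition (univ : Finset V), A ≤ A' ∧
      modularity G - modScore G A' ≤ modularity H - modScore H A + (2 / k + 6 * k * η) := by
  obtain ⟨A', hAA', hcard, hscore⟩ := exists_coarsening_modScore_ge hH A hk
  obtain ⟨O, hO⟩ := exists_modScore_eq_modularity G
  obtain ⟨O', -, hcardO, hscoreO⟩ := exists_coarsening_modScore_ge hG O hk
  refine ⟨A', hAA', ?_⟩
  have hbound : ∀ P : Finpartition (univ : Finset V), P.parts.card ≤ k →
      |modScore G P - modScore H P| ≤ k * (3 * η) := fun P hP =>
    (abs_modScore_sub_modScore_le hG hH h P).trans (by gcongr)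
  have h1 := abs_le.1 (hbound A' hcard)
  have h2 := abs_le.1 (hbound O' hcardO)
  have h3 : modScore H O' ≤ modularity H := modScore_le_modularity O'
  have h4 : (2 : ℝ) / k = 1 / k + 1 / k := by ring
  linarith

/-- If the numbers of internal edges of `H` are about `p` times those of `G`, then the proportions
of internal edges are similar. -/
lemma abs_edgeFrac_sub_edgeFrac_le {p δ : ℝ} (hp : 0 < p) (hδ : 0 ≤ δ) (hδ2 : δ ≤ 1 / 2)
    (hG : edgeCount G ≠ 0)
    (h : ∀ S, |(intEdges H S : ℝ) - p * intEdges G S| ≤ δ * (p * edgeCount G)) :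
    edgeCount H ≠ 0 ∧ ∀ S, |edgeFrac G S - edgeFrac H S| ≤ 4 * δ := by
  have hm : (0 : ℝ) < edgeCount G := by exact_mod_cast Nat.pos_of_ne_zero hG
  have huniv : ∀ K : SimpleGraph V, intEdges K univ = edgeCount K := fun K => by
    simp [intEdges, edgeCount]
  have hcount := h univ
  rw [huniv, huniv] at hcount
  have hpm : 0 < p * edgeCount G := by positivity
  have hlow : p * (edgeCount G : ℝ) / 2 ≤ edgeCount H := by
    have := (abs_le.1 hcount).1
    nlinarith
  have hmH : (0 : ℝ) < edgeCount H := by linarith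
  refine ⟨by exact_mod_cast hmH.ne', fun S => ?_⟩
  have hle : (intEdges G S : ℝ) ≤ edgeCount G := by exact_mod_cast intEdges_le_edgeCount G S
  have hsplit : edgeFrac G S - edgeFrac H S =
      (edgeFrac G S * (edgeCount H - p * edgeCount G) -
        (intEdges H S - p * intEdges G S)) / edgeCount H := by
    unfold edgeFrac
    field_simp
    ring
  rw [hsplit, abs_div, abs_of_pos hmH, div_le_iff₀ hmH]
  have hnum : |edgeFrac G S * (edgeCount H - p * edgeCount G) -
      (intEdges H S - p * intEdges G S)| ≤
      1 * (δ * (p * edgeCount G)) + δ * (p * edgeCount G) := by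
    refine (abs_sub _ _).trans (add_le_add ?_ (h S))
    rw [abs_mul, abs_of_nonneg (edgeFrac_nonneg G S)]
    gcongr
    exact edgeFrac_le_one G S
  nlinarith

lemma intEdges_fromEdgeSet {F : Finset (Sym2 V)} (hF : F ⊆ G.edgeFinset) (S : Finset V) :
    intEdges (SimpleGraph.fromEdgeSet (F : Set (Sym2 V))) S =
      (F ∩ G.edgeFinset.filter (fun e => ∀ v ∈ e, v ∈ S)).card := by
  rw [intEdges, edgeFinset_fromEdgeSet_of_subset hF, inter_filter, inter_eq_left.2 hF]

/-- The random subgraph has about the expected number of edges inside every vertex set, except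
with probability exponentially small in the expected number of edges. -/
lemma one_sub_le_subgraphProb {p δ : ℝ} (hp : 0 ≤ p) (hp1 : p ≤ 1) (hδ : 0 ≤ δ) (hδ2 : δ ≤ 2)
    (Q : SimpleGraph V → Prop)
    (hQ : ∀ H : SimpleGraph V, (∀ S, |(intEdges H S : ℝ) - p * intEdges G S| ≤
      δ * (p * edgeCount G)) → Q H) :
    1 - (2 : ℝ) ^ Fintype.card V * (2 * Real.exp (-(p * edgeCount G * δ ^ 2 / 4))) ≤
      subgraphProb G p Q := by
  have := one_sub_le_sum_retainWeight G.edgeFinset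
    (fun S : Finset V => G.edgeFinset.filter (fun e => ∀ v ∈ e, v ∈ S))
    (fun S => filter_subset _ _) hp hp1 hδ hδ2
    (fun F => Q (SimpleGraph.fromEdgeSet (F : Set (Sym2 V)))) (by
      intro F hF hdev
      refine hQ _ fun S => ?_
      rw [intEdges_fromEdgeSet hF]
      exact hdev S)
  rw [Fintype.card_finset] at this
  push_cast at this
  exact this

end Graphs

lemma two_pow_mul_two_mul_exp_le {ε x : ℝ} (hε : 0 < ε) {n : ℕ} (hn : 1 ≤ n)
    (hx : (2 + 1 / ε) * n ≤ x) : (2 : ℝ) ^ n * (2 * Real.exp (-x)) ≤ ε := by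
  have hnR : (1 : ℝ) ≤ n := by exact_mod_cast hn
  have hexp : (2 : ℝ) ≤ Real.exp 1 := by
    have := Real.add_one_le_exp 1
    linarith
  have hinv : 1 / ε ≤ Real.exp (1 / ε) := by
    have := Real.add_one_le_exp (1 / ε)
    linarith
  have hpow : (2 : ℝ) ^ n ≤ Real.exp n := by
    calc (2 : ℝ) ^ n ≤ Real.exp 1 ^ n := by gcongr
      _ = Real.exp n := by rw [← Real.exp_nat_mul, mul_one]
  have hlin : 1 / ε ≤ 1 / ε * n := le_mul_of_one_le_right (by positivity) hnR
  calc (2 : ℝ) ^ n * (2 * Real.exp (-x))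
      ≤ Real.exp n * (Real.exp 1 * Real.exp (-x)) := by gcongr
    _ = Real.exp (n + (1 + -x)) := by rw [← Real.exp_add, ← Real.exp_add]
    _ ≤ Real.exp (-(1 / ε)) := by
        apply Real.exp_le_exp.2
        nlinarith
    _ = (Real.exp (1 / ε))⁻¹ := Real.exp_neg _
    _ ≤ (1 / ε)⁻¹ := by gcongr
    _ = ε := by simp

/-- Theorem 2(b): for every ε > 0 there is c = c(ε) > 0 such that for every finite
graph G and probability 0 < p ≤ 1 with e(G)·p / v(G) ≥ c, with probability at
least 1 − ε the following event holds: for every partition 𝒜 of V(G) there is a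
partition 𝒜′ of V(G) whose parts are unions of parts of 𝒜 (i.e. 𝒜 refines 𝒜′),
depending only on the realization of G_p and on 𝒜, such that
δ_{𝒜′}(G) ≤ δ_𝒜(G_p) + ε, where δ_𝒜(G) = q*(G) − q_𝒜(G). -/
theorem statement2 :
    ∀ ε : ℝ, 0 < ε →
      ∃ c : ℝ, 0 < c ∧
        ∀ (V : Type) [Fintype V] [DecidableEq V] (G : SimpleGraph V) (p : ℝ),
          0 < p → p ≤ 1 → c ≤ (edgeCount G : ℝ) * p / (Fintype.card V : ℝ) →
          1 - ε ≤ subgraphProb G p (fun H =>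
            ∀ A : Finpartition (univ : Finset V),
              ∃ A' : Finpartition (univ : Finset V), A ≤ A' ∧
                modularity G - modScore G A' ≤ (modularity H - modScore H A) + ε) := by
  intro ε hε
  obtain ⟨k, hk⟩ := exists_nat_ge (4 / ε)
  have hkR : (0 : ℝ) < k := lt_of_lt_of_le (by positivity) hk
  have hk0 : 0 < k := by exact_mod_cast hkR
  set δ : ℝ := min (1 / 2) (ε / (48 * k)) with hδ
  have hδ0 : 0 < δ := by positivity
  have hδ2 : δ ≤ 1 / 2 := min_le_left _ _
  have herr : (2 : ℝ) / k + 6 * k * (4 * δ) ≤ ε := by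
    have h1 : (2 : ℝ) / k ≤ ε / 2 := by
      rw [div_le_iff₀ hε] at hk
      rw [div_le_iff₀ hkR]
      linarith
    have h2 : δ * (48 * k) ≤ ε := (le_div_iff₀ (by positivity)).1 (min_le_right _ _)
    linarith
  refine ⟨4 / δ ^ 2 * (2 + 1 / ε), by positivity, ?_⟩
  intro V _ _ G p hp hp1 hc
  have hquot : 0 < (edgeCount G : ℝ) * p / (Fintype.card V : ℝ) := lt_of_lt_of_le (by positivity) hc
  have hn : 1 ≤ Fintype.card V := by
    by_contra! h
    have : Fintype.card V = 0 := by omega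
    simp [this] at hquot
  have hnR : (0 : ℝ) < Fintype.card V := by exact_mod_cast hn
  have hG : edgeCount G ≠ 0 := by
    intro h
    simp [h] at hquot
  rw [le_div_iff₀ hnR] at hc
  have hx : (2 + 1 / ε) * (Fintype.card V : ℝ) ≤ p * edgeCount G * δ ^ 2 / 4 := by
    have : (2 + 1 / ε) * (Fintype.card V : ℝ) =
        4 / δ ^ 2 * (2 + 1 / ε) * (Fintype.card V : ℝ) * (δ ^ 2 / 4) := by
      field_simp
    rw [this]
    calc _ ≤ (edgeCount G : ℝ) * p * (δ ^ 2 / 4) := by gcongr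
      _ = _ := by ring
  refine le_trans ?_ (one_sub_le_subgraphProb hp.le hp1 hδ0.le (hδ2.trans (by norm_num)) _ ?_)
  · linarith [two_pow_mul_two_mul_exp_le hε hn hx]
  · intro H hH A
    obtain ⟨hH0, hfrac⟩ := abs_edgeFrac_sub_edgeFrac_le hp hδ0.le hδ2 hG hH
    obtain ⟨A', hAA', hA'⟩ :=
      exists_coarsening_deficit_le hG hH0 (by positivity) hfrac hk0 A
    exact ⟨A', hAA', hA'.trans (by linarith)⟩
end

section
/- Let m and k be integers with 1 ≤ k and k + 1 < m, and let G be the graph with m edges consisting of a star with m − k edges together with k pairwise disjoint edges (and no other edges). Then q*(G) = 2k/m − (k² + k)/m² > k/m, and for every p with 0 < p < 1 the random subgraph G_p satisfies P( q*(G_p) = 0 ) ≥ (1 − p)^k. -/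
open Finset
open scoped Classical

/-- The graph consisting of a star with a edges (centre `none`, leaves the
`some (Sum.inl i)`) together with k pairwise disjoint edges (the pairs
`some (Sum.inr (j, 0)) — some (Sum.inr (j, 1))`), and no other edges. -/
noncomputable def starPlusMatching (a k : ℕ) :
    SimpleGraph (Option (Fin a ⊕ Fin k × Fin 2)) :=
  SimpleGraph.fromEdgeSet
    ({e | ∃ i : Fin a, e = s(none, some (Sum.inl i))} ∪
     {e | ∃ j : Fin k, e = s(some (Sum.inr (j, 0)), some (Sum.inr (j, 1)))})

/-- Twice the number of edges is the volume of the whole vertex set. -/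
lemma degSum_univ {V : Type} [Fintype V] [DecidableEq V] (G : SimpleGraph V) :
    degSum G univ = 2 * edgeCount G := by
  unfold degSum edgeCount
  rw [← SimpleGraph.sum_degrees_eq_twice_card_edges]

lemma intEdges_univ {V : Type} [Fintype V] [DecidableEq V] (G : SimpleGraph V) :
    intEdges G univ = edgeCount G := by
  simp [intEdges, edgeCount]

lemma modScore_eq_div {V : Type} [Fintype V] [DecidableEq V] (G : SimpleGraph V)
    (P : Finpartition (univ : Finset V)) :
    modScore G P = (∑ A ∈ P.parts, (4 * (edgeCount G : ℝ) * (intEdges G A : ℝ)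
      - (degSum G A : ℝ) ^ 2)) / (4 * (edgeCount G : ℝ) ^ 2) := by
  unfold modScore
  split_ifs with h
  · simp [h]
  · have h' : (edgeCount G : ℝ) ≠ 0 := by exact_mod_cast h
    rw [Finset.sum_sub_distrib, ← Finset.mul_sum]
    field_simp

/-- The modularity is `q` as soon as `q` bounds all scores and is attained. -/
lemma modularity_eq_of_le_of_eq {V : Type} [Fintype V] [DecidableEq V] (G : SimpleGraph V)
    (q : ℝ) (hle : ∀ P, modScore G P ≤ q) (P₀ : Finpartition (univ : Finset V))
    (hP₀ : modScore G P₀ = q) : modularity G = q := by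
  have : Nonempty (Finpartition (univ : Finset V)) := ⟨P₀⟩
  unfold modularity
  apply le_antisymm (ciSup_le hle)
  rw [← hP₀]
  exact le_ciSup (f := fun P => modScore G P) ⟨q, by rintro _ ⟨P, rfl⟩; exact hle P⟩ P₀

lemma modScore_indiscrete {V : Type} [Fintype V] [DecidableEq V] (G : SimpleGraph V)
    (h : (univ : Finset V) ≠ ⊥) : modScore G (Finpartition.indiscrete h) = 0 := by
  rw [modScore_eq_div]
  simp only [Finpartition.indiscrete_parts, Finset.sum_singleton, degSum_univ, intEdges_univ]
  push_cast
  ring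

/-- In a graph all of whose edges contain `c`, a vertex set `A` satisfies
`4 e(G) e(A) ≤ vol(A)²`. -/
lemma star_intEdges_le {V : Type} [Fintype V] [DecidableEq V] (G : SimpleGraph V) (c : V)
    (hc : ∀ e ∈ G.edgeSet, c ∈ e) (A : Finset V) :
    4 * edgeCount G * intEdges G A ≤ degSum G A ^ 2 := by
  by_cases hA : c ∈ A
  · have hdeg : G.degree c = edgeCount G := by
      rw [← SimpleGraph.card_incidenceFinset_eq_degree, edgeCount]
      congr 1
      ext e
      simp only [SimpleGraph.mem_incidenceFinset, SimpleGraph.incidenceSet, Set.mem_ofPred_eq,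
        SimpleGraph.mem_edgeFinset]
      exact ⟨fun h => h.1, fun h => ⟨h, hc e h⟩⟩
    have hint : intEdges G A ≤ ∑ v ∈ A.erase c, G.degree v := by
      calc intEdges G A ≤ ((A.erase c).biUnion fun v => G.incidenceFinset v).card := by
            apply Finset.card_le_card
            intro e he
            simp only [Finset.mem_filter, SimpleGraph.mem_edgeFinset] at he
            obtain ⟨he, heA⟩ := he
            obtain ⟨w, rfl⟩ := hc e he
            have hne : w ≠ c := (G.ne_of_adj he).symm
            simp only [Finset.mem_biUnion, Finset.mem_erase, SimpleGraph.mem_incidenceFinset,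
              SimpleGraph.incidenceSet, Set.mem_ofPred_eq]
            exact ⟨w, ⟨hne, heA w (by simp)⟩, he, by simp⟩
        _ ≤ ∑ v ∈ A.erase c, (G.incidenceFinset v).card := Finset.card_biUnion_le
        _ = _ := by simp only [SimpleGraph.card_incidenceFinset_eq_degree]
    have hvol : degSum G A = edgeCount G + ∑ v ∈ A.erase c, G.degree v := by
      rw [degSum, ← Finset.add_sum_erase A _ hA, hdeg]
    rw [hvol]
    generalize (∑ v ∈ A.erase c, G.degree v) = s at *
    zify at *
    nlinarith [sq_nonneg ((edgeCount G : ℤ) - s),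
      mul_le_mul_of_nonneg_left hint (Int.natCast_nonneg (edgeCount G))]
  · have : intEdges G A = 0 := by
      rw [intEdges, Finset.card_eq_zero, Finset.filter_eq_empty_iff]
      intro e he h
      exact hA (h c (hc e (SimpleGraph.mem_edgeFinset.1 he)))
    simp [this]

/-- Stars have modularity zero. -/
lemma modularity_star {V : Type} [Fintype V] [DecidableEq V] (G : SimpleGraph V) (c : V)
    (hc : ∀ e ∈ G.edgeSet, c ∈ e) : modularity G = 0 := by
  have hne : (univ : Finset V) ≠ ⊥ := Finset.Nonempty.ne_empty ⟨c, mem_univ c⟩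
  refine modularity_eq_of_le_of_eq G 0 (fun P => ?_) _ (modScore_indiscrete G hne)
  rw [modScore_eq_div]
  refine div_nonpos_of_nonpos_of_nonneg (Finset.sum_nonpos fun A _ => ?_) (by positivity)
  have := star_intEdges_le G c hc A
  rw [sub_nonpos]
  exact_mod_cast this

/-- The edges of `starPlusMatching a k`, indexed by the leaves and the disjoint edges. -/
def spmEdge (a k : ℕ) : Fin a ⊕ Fin k → Sym2 (Option (Fin a ⊕ Fin k × Fin 2))
  | Sum.inl i => s(none, some (Sum.inl i))
  | Sum.inr j => s(some (Sum.inr (j, 0)), some (Sum.inr (j, 1)))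

lemma spmEdge_injective (a k : ℕ) : Function.Injective (spmEdge a k) := by
  rintro (i | i) (j | j) h <;> simp_all [spmEdge]

lemma mem_edgeSet_starPlusMatching (a k : ℕ) (e : Sym2 (Option (Fin a ⊕ Fin k × Fin 2))) :
    e ∈ (starPlusMatching a k).edgeSet ↔ ∃ x, spmEdge a k x = e := by
  rw [starPlusMatching, SimpleGraph.edgeSet_fromEdgeSet]
  constructor
  · rintro ⟨⟨i, rfl⟩ | ⟨j, rfl⟩, -⟩
    · exact ⟨Sum.inl i, rfl⟩
    · exact ⟨Sum.inr j, rfl⟩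
  · rintro ⟨i | j, rfl⟩
    · exact ⟨Or.inl ⟨i, rfl⟩, by simp [spmEdge]⟩
    · exact ⟨Or.inr ⟨j, rfl⟩, by simp [spmEdge]⟩

lemma edgeFinset_starPlusMatching (a k : ℕ) [Fintype (starPlusMatching a k).edgeSet] :
    (starPlusMatching a k).edgeFinset = univ.map ⟨spmEdge a k, spmEdge_injective a k⟩ := by
  ext e
  simp [SimpleGraph.mem_edgeFinset, mem_edgeSet_starPlusMatching]

lemma card_filter_edgeFinset_starPlusMatching (a k : ℕ)
    [Fintype (starPlusMatching a k).edgeSet]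
    (Q : Sym2 (Option (Fin a ⊕ Fin k × Fin 2)) → Prop) [DecidablePred Q] :
    ((starPlusMatching a k).edgeFinset.filter Q).card =
      (∑ i, if Q (spmEdge a k (Sum.inl i)) then 1 else 0) +
        ∑ j, if Q (spmEdge a k (Sum.inr j)) then 1 else 0 := by
  rw [edgeFinset_starPlusMatching, Finset.card_filter, Finset.sum_map, Fintype.sum_sum_type]
  rfl

lemma edgeCount_starPlusMatching (a k : ℕ) : edgeCount (starPlusMatching a k) = a + k := by
  rw [edgeCount, edgeFinset_starPlusMatching]
  simp

lemma degree_starPlusMatching (a k : ℕ) (v : Option (Fin a ⊕ Fin k × Fin 2))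
    [Fintype ((starPlusMatching a k).neighborSet v)] :
    (starPlusMatching a k).degree v = if v = none then a else 1 := by
  have h : (starPlusMatching a k).degree v =
      ((starPlusMatching a k).edgeFinset.filter (v ∈ ·)).card := by
    rw [← SimpleGraph.card_incidenceFinset_eq_degree]
    congr 1
    ext e
    simp [SimpleGraph.mem_incidenceFinset, SimpleGraph.incidenceSet]
  rw [h, card_filter_edgeFinset_starPlusMatching]
  rcases v with _ | i | ⟨j, b⟩
  · simp [spmEdge]
  · simp [spmEdge]
  · fin_cases b <;> simp [spmEdge]

lemma degSum_starPlusMatching (a k : ℕ) (A : Finset (Option (Fin a ⊕ Fin k × Fin 2))) :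
    degSum (starPlusMatching a k) A = (if none ∈ A then a else 0) +
      ((∑ i, if some (Sum.inl i) ∈ A then 1 else 0) +
        ∑ j, ((if some (Sum.inr (j, 0)) ∈ A then 1 else 0) +
          if some (Sum.inr (j, 1)) ∈ A then 1 else 0)) := by
  have h : degSum (starPlusMatching a k) A =
      ∑ v, if v ∈ A then (if v = none then a else 1) else 0 := by
    rw [degSum, Finset.sum_ite_mem, Finset.univ_inter]
    exact Finset.sum_congr rfl fun v _ => degree_starPlusMatching a k v
  rw [h, Fintype.sum_option, Fintype.sum_sum_type, Fintype.sum_prod_type]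
  simp only [Fin.sum_univ_two]
  simp

lemma intEdges_starPlusMatching (a k : ℕ) (A : Finset (Option (Fin a ⊕ Fin k × Fin 2))) :
    intEdges (starPlusMatching a k) A =
      (∑ i, if none ∈ A ∧ some (Sum.inl i) ∈ A then 1 else 0) +
        ∑ j, if some (Sum.inr (j, 0)) ∈ A ∧ some (Sum.inr (j, 1)) ∈ A then 1 else 0 := by
  rw [intEdges, card_filter_edgeFinset_starPlusMatching]
  simp [spmEdge]

/-- The vertex weights that bound the contribution of each part to the modularity score. -/
def spmWeight (a k : ℕ) (v : Option (Fin a ⊕ Fin k × Fin 2)) : ℝ :=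
  match v with
  | none => 4 * a * k
  | some (Sum.inl _) => 0
  | some (Sum.inr _) => 2 * (a + k) - 2

lemma sum_sq_le_sq_sum_of_nonneg {ι : Type*} (s : Finset ι) (f : ι → ℝ)
    (hf : ∀ i ∈ s, 0 ≤ f i) : ∑ i ∈ s, f i ^ 2 ≤ (∑ i ∈ s, f i) ^ 2 := by
  rw [sq (∑ i ∈ s, f i), Finset.sum_mul]
  refine Finset.sum_le_sum fun i hi => ?_
  rw [sq]
  exact mul_le_mul_of_nonneg_left (Finset.single_le_sum hf hi) (hf i hi)

lemma starPlusMatching_part_le (a k : ℕ) (hak : 1 ≤ a + k)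
    (A : Finset (Option (Fin a ⊕ Fin k × Fin 2))) :
    4 * ((a + k : ℕ) : ℝ) * (intEdges (starPlusMatching a k) A : ℝ)
      - (degSum (starPlusMatching a k) A : ℝ) ^ 2 ≤ ∑ v ∈ A, spmWeight a k v := by
  have hw : ∑ v ∈ A, spmWeight a k v = (if none ∈ A then 4 * (a : ℝ) * k else 0) +
      ∑ j : Fin k, (2 * ((a : ℝ) + k) - 2) * ((if some (Sum.inr (j, 0)) ∈ A then 1 else 0) +
          if some (Sum.inr (j, 1)) ∈ A then 1 else 0) := by
    have : ∑ v ∈ A, spmWeight a k v = ∑ v, if v ∈ A then spmWeight a k v else 0 := by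
      rw [Finset.sum_ite_mem, Finset.univ_inter]
    rw [this, Fintype.sum_option, Fintype.sum_sum_type, Fintype.sum_prod_type]
    simp only [Fin.sum_univ_two]
    simp [spmWeight, mul_add]
  rw [hw, degSum_starPlusMatching, intEdges_starPlusMatching]
  push_cast
  have hak' : (1 : ℝ) ≤ a + k := by exact_mod_cast hak
  set x : ℝ := ∑ i : Fin a, if some (Sum.inl i) ∈ A then (1 : ℝ) else 0 with hx
  set t : Fin k → ℝ := fun j => (if some (Sum.inr (j, 0)) ∈ A then (1 : ℝ) else 0) +
          if some (Sum.inr (j, 1)) ∈ A then 1 else 0 with ht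
  have ht0 : ∀ j, 0 ≤ t j := fun j => by simp only [ht]; positivity
  have hx0 : 0 ≤ x := Finset.sum_nonneg fun i _ => by positivity
  have hxa : x ≤ a := by
    calc x ≤ ∑ i : Fin a, (1 : ℝ) := Finset.sum_le_sum fun i _ => by split_ifs <;> norm_num
      _ = a := by simp
  have hmatch : 4 * ((a : ℝ) + k) * (∑ j : Fin k,
      if some (Sum.inr (j, 0)) ∈ A ∧ some (Sum.inr (j, 1)) ∈ A then (1 : ℝ) else 0)
      - (∑ j, t j) ^ 2 ≤ ∑ j, (2 * ((a : ℝ) + k) - 2) * t j := by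
    have hsq := sum_sq_le_sq_sum_of_nonneg univ t fun j _ => ht0 j
    refine (sub_le_sub_left hsq _).trans ?_
    rw [Finset.mul_sum, ← Finset.sum_sub_distrib]
    refine Finset.sum_le_sum fun j _ => ?_
    simp only [ht]
    by_cases h0 : some (Sum.inr (j, 0)) ∈ A <;> by_cases h1 : some (Sum.inr (j, 1)) ∈ A <;>
      simp only [h0, h1, if_true, if_false, and_self, and_true, and_false] <;> linarith
  have hT : 0 ≤ ∑ j, t j := Finset.sum_nonneg fun j _ => ht0 j
  have ha0 : (0 : ℝ) ≤ a := Nat.cast_nonneg a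
  have hk0 : (0 : ℝ) ≤ k := Nat.cast_nonneg k
  by_cases hn : none ∈ A
  · simp only [hn, true_and, if_true, ← hx]
    nlinarith [mul_nonneg ha0 hT, mul_nonneg hx0 hT, mul_nonneg hk0 (sub_nonneg.2 hxa),
      sq_nonneg ((a : ℝ) - x)]
  · simp only [hn, false_and, if_false, Finset.sum_const_zero]
    nlinarith [mul_nonneg hx0 hT]

lemma sum_spmWeight (a k : ℕ) :
    ∑ v, spmWeight a k v = 4 * a * k + 4 * k * (a + k) - 4 * k := by
  rw [Fintype.sum_option, Fintype.sum_sum_type, Fintype.sum_prod_type]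
  simp [spmWeight]
  ring

/-- The component of `starPlusMatching a k` containing a vertex: `none` for the star. -/
def spmComponent (a k : ℕ) : Option (Fin a ⊕ Fin k × Fin 2) → Option (Fin k)
  | none => none
  | some (Sum.inl _) => none
  | some (Sum.inr (j, _)) => some j

lemma spmComponent_surjective (a k : ℕ) : Function.Surjective (spmComponent a k)
  | none => ⟨none, rfl⟩
  | some j => ⟨some (Sum.inr (j, 0)), rfl⟩

/-- The partition of a finite type into the fibres of a surjection. -/
noncomputable def fibrePartition {V W : Type} [Fintype V] [DecidableEq V] [Fintype W]
    (g : V → W) (hg : Function.Surjective g) : Finpartition (univ : Finset V) where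
  parts := univ.image fun w => univ.filter fun v => g v = w
  supIndep := by
    rw [Finset.supIndep_iff_pairwiseDisjoint]
    intro s hs t ht hst
    simp only [Finset.coe_image, Set.mem_image, Finset.coe_univ, Set.mem_univ, true_and] at hs ht
    obtain ⟨w, rfl⟩ := hs
    obtain ⟨w', rfl⟩ := ht
    simp only [Function.onFun, id]
    rw [Finset.disjoint_left]
    intro v hv hv'
    simp only [Finset.mem_filter, Finset.mem_univ, true_and] at hv hv'
    exact hst (by rw [← hv, ← hv'])
  sup_parts := by
    ext v
    simp
  bot_notMem := by
    simp only [Finset.mem_image, Finset.mem_univ, true_and, not_exists]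
    intro w h
    obtain ⟨v, hv⟩ := hg w
    have : v ∈ (⊥ : Finset V) := by rw [← h]; simp [hv]
    simp at this

lemma sum_fibrePartition {V W : Type} [Fintype V] [DecidableEq V] [Fintype W]
    (g : V → W) (hg : Function.Surjective g) (f : Finset V → ℝ) :
    ∑ A ∈ (fibrePartition g hg).parts, f A = ∑ w, f (univ.filter fun v => g v = w) := by
  unfold fibrePartition
  refine Finset.sum_image fun w _ w' _ h => ?_
  obtain ⟨v, hv⟩ := hg w
  have : v ∈ univ.filter fun v => g v = w' := by
    rw [← h]; simp [hv]
  simpa [hv] using this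

lemma modularity_starPlusMatching (a k : ℕ) (hak : 1 ≤ a + k) :
    modularity (starPlusMatching a k) =
      (4 * a * k + 4 * k * (a + k) - 4 * k) / (4 * ((a : ℝ) + k) ^ 2) := by
  refine modularity_eq_of_le_of_eq _ _ (fun P => ?_)
    (fibrePartition (spmComponent a k) (spmComponent_surjective a k)) ?_
  · rw [modScore_eq_div, edgeCount_starPlusMatching, ← sum_spmWeight]
    push_cast
    refine div_le_div_of_nonneg_right ?_ (by positivity)
    have hsum : ∑ v, spmWeight a k v = ∑ A ∈ P.parts, ∑ v ∈ A, spmWeight a k v := by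
      conv_lhs => rw [← P.biUnion_parts]
      exact Finset.sum_biUnion P.disjoint
    rw [hsum]
    refine Finset.sum_le_sum fun A _ => ?_
    exact_mod_cast starPlusMatching_part_le a k hak A
  · rw [modScore_eq_div, edgeCount_starPlusMatching, sum_fibrePartition, Fintype.sum_option]
    simp only [degSum_starPlusMatching, intEdges_starPlusMatching, Finset.mem_filter,
      Finset.mem_univ, true_and]
    simp [spmComponent, ← two_mul]
    ring

/-- If removing a set of edges leaves a star centred at `c`, the modularity of the random
subgraph vanishes with at least the probability that all these edges are removed. -/
lemma le_subgraphProb_modularity_eq_zero {V : Type} [Fintype V] [DecidableEq V]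
    (G : SimpleGraph V) (c : V) (p : ℝ) (h0 : 0 ≤ p) (h1 : p ≤ 1) :
    (1 - p) ^ (G.edgeFinset.filter (c ∉ ·)).card ≤
      subgraphProb G p (fun H => modularity H = 0) := by
  set S := G.edgeFinset.filter (c ∈ ·) with hS
  have hcard : S.card + (G.edgeFinset.filter (c ∉ ·)).card = G.edgeFinset.card :=
    Finset.card_filter_add_card_filter_not _
  have hsub : S ⊆ G.edgeFinset := Finset.filter_subset _ _
  have h1' : 0 ≤ 1 - p := sub_nonneg.2 h1
  unfold subgraphProb
  calc (1 - p) ^ (G.edgeFinset.filter (c ∉ ·)).card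
      = (1 - p) ^ (G.edgeFinset.filter (c ∉ ·)).card *
          ∑ F ∈ S.powerset, p ^ F.card * (1 - p) ^ (S.card - F.card) := by
        rw [Finset.sum_pow_mul_eq_add_pow]; simp
    _ = ∑ F ∈ S.powerset,
          if modularity (SimpleGraph.fromEdgeSet (F : Set (Sym2 V))) = 0 then
            p ^ F.card * (1 - p) ^ (G.edgeFinset.card - F.card) else 0 := by
        rw [Finset.mul_sum]
        refine Finset.sum_congr rfl fun F hF => ?_
        rw [Finset.mem_powerset] at hF
        have hle := Finset.card_le_card hF
        rw [if_pos, ← hcard, Nat.sub_add_comm hle, pow_add]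
        · ring
        · refine modularity_star _ c fun e he => ?_
          rw [SimpleGraph.edgeSet_fromEdgeSet] at he
          exact (Finset.mem_filter.1 (hF (Finset.mem_coe.1 he.1))).2
    _ ≤ _ := by
        refine Finset.sum_le_sum_of_subset_of_nonneg (Finset.powerset_mono.2 hsub)
          fun F _ _ => ?_
        split_ifs
        · positivity
        · exact le_rfl

/-- For 1 ≤ k and k + 1 < m, the m-edge graph G consisting of a star with m − k edges
together with k disjoint edges satisfies q*(G) = 2k/m − (k² + k)/m² > k/m, and for
every 0 < p < 1 the random subgraph G_p has q*(G_p) = 0 with probability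
at least (1 − p)^k. -/
theorem statement9 (m k : ℕ) (hk : 1 ≤ k) (hm : k + 1 < m) :
    edgeCount (starPlusMatching (m - k) k) = m ∧
    modularity (starPlusMatching (m - k) k)
      = 2 * (k : ℝ) / m - ((k : ℝ) ^ 2 + k) / (m : ℝ) ^ 2 ∧
    (k : ℝ) / m < 2 * (k : ℝ) / m - ((k : ℝ) ^ 2 + k) / (m : ℝ) ^ 2 ∧
    ∀ p : ℝ, 0 < p → p < 1 →
      (1 - p) ^ k ≤
        subgraphProb (starPlusMatching (m - k) k) p (fun H => modularity H = 0) := by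
  obtain ⟨a, rfl⟩ : ∃ a, m = a + k := ⟨m - k, by omega⟩
  rw [Nat.add_sub_cancel]
  have ha : (1 : ℝ) < a := by exact_mod_cast (by omega : 1 < a)
  have hk' : (1 : ℝ) ≤ k := by exact_mod_cast hk
  have hpos : (0 : ℝ) < a + k := by linarith
  refine ⟨edgeCount_starPlusMatching a k, ?_, ?_, fun p h0 h1 => ?_⟩
  · rw [modularity_starPlusMatching a k (by omega)]
    push_cast
    field_simp
    ring
  · push_cast
    rw [← sub_pos]
    have : 2 * (k : ℝ) / (a + k) - ((k : ℝ) ^ 2 + k) / (a + k) ^ 2 - k / (a + k)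
        = k * (a - 1) / (a + k) ^ 2 := by
      field_simp
      ring
    rw [this]
    have : 0 < (a : ℝ) - 1 := by linarith
    positivity
  · have h := le_subgraphProb_modularity_eq_zero (starPlusMatching a k) none p h0.le h1.le
    rw [card_filter_edgeFinset_starPlusMatching] at h
    simpa [spmEdge] using h
end
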